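/- For all n, m ∈ ℕ, the two expressions for the Landau-basis prefactor agree: ((z − ∂_{z̄})^m (w ↦ conj(w)^n))(z) = ((z̄ − ∂_z)^n (w ↦ w^m))(z) for every z ∈ ℂ. Here (z − ∂_{z̄}) sends a smooth F : ℂ → ℂ to z ↦ z·F(z) − (∂_{z̄} F)(z), and (z̄ − ∂_z) sends F to z ↦ conj(z)·F(z) − (∂_z F)(z). -/

import Mathlib

noncomputable section

/-- Wirtinger derivative `∂_z F = ½(∂_x F − i ∂_y F)`. -/
def dz (F : ℂ → ℂ) (z : ℂ) : ℂ :=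
  (1 / 2 : ℂ) * (fderiv ℝ F z 1 - Complex.I * fderiv ℝ F z Complex.I)

/-- Wirtinger derivative `∂_{z̄} F = ½(∂_x F + i ∂_y F)`. -/
def dzbar (F : ℂ → ℂ) (z : ℂ) : ℂ :=
  (1 / 2 : ℂ) * (fderiv ℝ F z 1 + Complex.I * fderiv ℝ F z Complex.I)

/-- The operator `z̄ − ∂_z`, sending `F` to `z ↦ conj z · F z − (∂_z F) z`. -/
def Tbar (F : ℂ → ℂ) : ℂ → ℂ := fun z => (starRingEnd ℂ) z * F z - dz F z

/-- The operator `z − ∂_{z̄}`, sending `F` to `z ↦ z · F z − (∂_{z̄} F) z`. -/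
def Sop (F : ℂ → ℂ) : ℂ → ℂ := fun z => z * F z - dzbar F z

open scoped ContDiff in
/-- Directional derivatives of a smooth function are smooth. -/
theorem contDiff_fderiv_apply_const {F : ℂ → ℂ} (hF : ContDiff ℝ ∞ F) (v : ℂ) :
    ContDiff ℝ ∞ (fun z => fderiv ℝ F z v) :=
  (hF.fderiv_right (m := ∞) le_rfl).clm_apply contDiff_const

open scoped ContDiff in
theorem contDiff_dz {F : ℂ → ℂ} (hF : ContDiff ℝ ∞ F) : ContDiff ℝ ∞ (dz F) :=
  contDiff_const.mul ((contDiff_fderiv_apply_const hF 1).sub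
    (contDiff_const.mul (contDiff_fderiv_apply_const hF Complex.I)))

open scoped ContDiff in
theorem contDiff_dzbar {F : ℂ → ℂ} (hF : ContDiff ℝ ∞ F) : ContDiff ℝ ∞ (dzbar F) :=
  contDiff_const.mul ((contDiff_fderiv_apply_const hF 1).add
    (contDiff_const.mul (contDiff_fderiv_apply_const hF Complex.I)))

open scoped ContDiff in
theorem contDiff_conj : ContDiff ℝ ∞ (fun z : ℂ => (starRingEnd ℂ) z) :=
  Complex.conjCLE.contDiff

open scoped ContDiff in
theorem contDiff_Sop {F : ℂ → ℂ} (hF : ContDiff ℝ ∞ F) : ContDiff ℝ ∞ (Sop F) :=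
  (contDiff_id.mul hF).sub (contDiff_dzbar hF)

open scoped ContDiff in
theorem contDiff_Tbar {F : ℂ → ℂ} (hF : ContDiff ℝ ∞ F) : ContDiff ℝ ∞ (Tbar F) :=
  (contDiff_conj.mul hF).sub (contDiff_dz hF)

theorem dz_sub {F G : ℂ → ℂ} {z : ℂ} (hF : DifferentiableAt ℝ F z)
    (hG : DifferentiableAt ℝ G z) : dz (fun w => F w - G w) z = dz F z - dz G z := by
  simp only [dz, fderiv_fun_sub hF hG, sub_apply]
  ring

theorem dzbar_sub {F G : ℂ → ℂ} {z : ℂ} (hF : DifferentiableAt ℝ F z)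
    (hG : DifferentiableAt ℝ G z) : dzbar (fun w => F w - G w) z = dzbar F z - dzbar G z := by
  simp only [dzbar, fderiv_fun_sub hF hG, sub_apply]
  ring

theorem dz_mul {F G : ℂ → ℂ} {z : ℂ} (hF : DifferentiableAt ℝ F z)
    (hG : DifferentiableAt ℝ G z) :
    dz (fun w => F w * G w) z = F z * dz G z + dz F z * G z := by
  simp only [dz, fderiv_fun_mul hF hG, add_apply,
    smul_apply, smul_eq_mul]
  ring

theorem dzbar_mul {F G : ℂ → ℂ} {z : ℂ} (hF : DifferentiableAt ℝ F z)
    (hG : DifferentiableAt ℝ G z) :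
    dzbar (fun w => F w * G w) z = F z * dzbar G z + dzbar F z * G z := by
  simp only [dzbar, fderiv_fun_mul hF hG, add_apply,
    smul_apply, smul_eq_mul]
  ring

theorem fderiv_conj (z : ℂ) :
    fderiv ℝ (fun w : ℂ => (starRingEnd ℂ) w) z = (Complex.conjCLE : ℂ →L[ℝ] ℂ) :=
  Complex.conjCLE.hasFDerivAt.fderiv

theorem dz_id (z : ℂ) : dz (fun w => w) z = 1 := by
  simp only [dz, fderiv_fun_id, ContinuousLinearMap.id_apply, Complex.I_mul_I]
  norm_num

theorem dzbar_id (z : ℂ) : dzbar (fun w => w) z = 0 := by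
  simp [dzbar]

theorem dz_conj (z : ℂ) : dz (fun w => (starRingEnd ℂ) w) z = 0 := by
  simp [dz, fderiv_conj]

theorem dzbar_conj (z : ℂ) : dzbar (fun w => (starRingEnd ℂ) w) z = 1 := by
  simp only [dzbar, fderiv_conj, ContinuousLinearEquiv.coe_coe, Complex.conjCLE_apply, map_one,
    Complex.conj_I, mul_neg, Complex.I_mul_I]
  norm_num

theorem dzbar_pow (m : ℕ) (z : ℂ) : dzbar (fun w => w ^ m) z = 0 := by
  induction m with
  | zero => simp [dzbar]
  | succ m ih =>
    simp only [pow_succ]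
    rw [dzbar_mul (by fun_prop) (by fun_prop), ih, dzbar_id]
    ring

theorem dz_conj_pow (n : ℕ) (z : ℂ) : dz (fun w => (starRingEnd ℂ) w ^ n) z = 0 := by
  have hconj : DifferentiableAt ℝ (fun w : ℂ => (starRingEnd ℂ) w) z :=
    Complex.conjCLE.differentiableAt
  induction n with
  | zero => simp [dz]
  | succ n ih =>
    simp only [pow_succ]
    rw [dz_mul (hconj.fun_pow n) hconj, ih, dz_conj]
    ring

open scoped ContDiff in
/-- The two Wirtinger derivatives commute on smooth functions. -/
theorem dz_dzbar_comm {F : ℂ → ℂ} (hF : ContDiff ℝ ∞ F) (z : ℂ) :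
    dz (dzbar F) z = dzbar (dz F) z := by
  have hd (v : ℂ) : DifferentiableAt ℝ (fun w => fderiv ℝ F w v) z :=
    (contDiff_fderiv_apply_const hF v).differentiable (by simp) z
  have hsymm : fderiv ℝ (fun w => fderiv ℝ F w 1) z Complex.I =
      fderiv ℝ (fun w => fderiv ℝ F w Complex.I) z 1 := by
    have hF' : DifferentiableAt ℝ (fderiv ℝ F) z :=
      (hF.fderiv_right (m := ∞) le_rfl).differentiable (by simp) z
    rw [fderiv_clm_apply hF' (by fun_prop), fderiv_clm_apply hF' (by fun_prop)]
    simpa using (hF.contDiffAt.isSymmSndFDerivAt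
      (by simpa using ENat.LEInfty.out)).eq Complex.I 1
  have hz (v : ℂ) : fderiv ℝ (dz F) z v = (1 / 2 : ℂ) * (fderiv ℝ (fun w => fderiv ℝ F w 1) z v -
      Complex.I * fderiv ℝ (fun w => fderiv ℝ F w Complex.I) z v) := by
    unfold dz
    rw [fderiv_const_mul (by fun_prop), fderiv_fun_sub (by fun_prop) (by fun_prop),
      fderiv_const_mul (by fun_prop)]
    simp
  have hzbar (v : ℂ) : fderiv ℝ (dzbar F) z v =
      (1 / 2 : ℂ) * (fderiv ℝ (fun w => fderiv ℝ F w 1) z v +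
        Complex.I * fderiv ℝ (fun w => fderiv ℝ F w Complex.I) z v) := by
    unfold dzbar
    rw [fderiv_const_mul (by fun_prop), fderiv_fun_add (by fun_prop) (by fun_prop),
      fderiv_const_mul (by fun_prop)]
    simp [mul_add]
  rw [dz, dzbar, hz, hz, hzbar, hzbar, hsymm]
  ring

open scoped ContDiff in
theorem Sop_Tbar_comm {F : ℂ → ℂ} (hF : ContDiff ℝ ∞ F) : Sop (Tbar F) = Tbar (Sop F) := by
  funext z
  have hd {G : ℂ → ℂ} (hG : ContDiff ℝ ∞ G) : DifferentiableAt ℝ G z :=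
    hG.differentiable (by simp) z
  have hT : dzbar (Tbar F) z =
      (starRingEnd ℂ) z * dzbar F z + F z - dzbar (dz F) z := by
    unfold Tbar
    rw [dzbar_sub (hd (contDiff_conj.mul hF)) (hd (contDiff_dz hF)),
      dzbar_mul (hd contDiff_conj) (hd hF), dzbar_conj, one_mul]
  have hS : dz (Sop F) z = z * dz F z + F z - dz (dzbar F) z := by
    unfold Sop
    rw [dz_sub (hd (contDiff_fun_id.mul hF)) (hd (contDiff_dzbar hF)),
      dz_mul differentiableAt_fun_id (hd hF), dz_id, one_mul]
  change z * Tbar F z - dzbar (Tbar F) z = (starRingEnd ℂ) z * Sop F z - dz (Sop F) z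
  rw [hT, hS, dz_dzbar_comm hF, Sop, Tbar]
  ring

open scoped ContDiff in
theorem contDiff_iterate_Sop {F : ℂ → ℂ} (hF : ContDiff ℝ ∞ F) (m : ℕ) :
    ContDiff ℝ ∞ (Sop^[m] F) :=
  Function.Iterate.rec (fun G => ContDiff ℝ ∞ G) hF (fun _ => contDiff_Sop) m

open scoped ContDiff in
theorem contDiff_iterate_Tbar {F : ℂ → ℂ} (hF : ContDiff ℝ ∞ F) (n : ℕ) :
    ContDiff ℝ ∞ (Tbar^[n] F) :=
  Function.Iterate.rec (fun G => ContDiff ℝ ∞ G) hF (fun _ => contDiff_Tbar) n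

open scoped ContDiff in
theorem iterate_Sop_Tbar {F : ℂ → ℂ} (hF : ContDiff ℝ ∞ F) (m : ℕ) :
    Sop^[m] (Tbar F) = Tbar (Sop^[m] F) := by
  induction m with
  | zero => rfl
  | succ m ih =>
    rw [Function.iterate_succ_apply', ih, Sop_Tbar_comm (contDiff_iterate_Sop hF m),
      Function.iterate_succ_apply']

open scoped ContDiff in
theorem iterate_Sop_iterate_Tbar {F : ℂ → ℂ} (hF : ContDiff ℝ ∞ F) (m n : ℕ) :
    Sop^[m] (Tbar^[n] F) = Tbar^[n] (Sop^[m] F) := by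
  induction n with
  | zero => rfl
  | succ n ih =>
    rw [Function.iterate_succ_apply', iterate_Sop_Tbar (contDiff_iterate_Tbar hF n), ih,
      Function.iterate_succ_apply']

theorem iterate_Sop_one (m : ℕ) : Sop^[m] (fun _ => 1) = fun w => w ^ m := by
  induction m with
  | zero => simp
  | succ m ih =>
    rw [Function.iterate_succ_apply', ih]
    funext z
    rw [Sop, dzbar_pow, sub_zero, pow_succ']

theorem iterate_Tbar_one (n : ℕ) :
    Tbar^[n] (fun _ => 1) = fun w => (starRingEnd ℂ) w ^ n := by
  induction n with
  | zero => simp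
  | succ n ih =>
    rw [Function.iterate_succ_apply', ih]
    funext z
    rw [Tbar, dz_conj_pow, sub_zero, pow_succ']

/-- the two expressions for the Landau-basis prefactor agree:
`((z − ∂_{z̄})^m (w ↦ conj(w)^n))(z) = ((z̄ − ∂_z)^n (w ↦ w^m))(z)` for all `z ∈ ℂ`. -/
theorem stmt8 (n m : ℕ) (z : ℂ) :
    (Sop^[m] (fun w => (starRingEnd ℂ) w ^ n)) z = (Tbar^[n] (fun w => w ^ m)) z := by
  rw [← iterate_Tbar_one, ← iterate_Sop_one, iterate_Sop_iterate_Tbar contDiff_const]
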